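/- arXiv:1411.4740 — 6 statements merged into one kernel-verified Lean document; each statement's English description precedes it below -/
import Mathlib

section
/- For every t ∈ {0, 1, 2, …}, the process satisfies E[e^{r Z(t+1)}] ≤ ρ · E[e^{r Z(t)}] + (e^{r δ_max} − ρ) e^{r θ}. -/
open MeasureTheory

/-- Bernstein's estimate: `exp y` exceeds its linear part by at most `(c² / 2) / (1 - c / 3)` when
`|y| ≤ c ≤ 1`. -/
theorem exp_le_one_add_add_of_abs_le {y c : ℝ} (hy : |y| ≤ c) (hc : c ≤ 1) :
    Real.exp y ≤ 1 + y + c ^ 2 / 2 / (1 - c / 3) := by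
  have hc0 : 0 ≤ c := (abs_nonneg y).trans hy
  have taylor := (abs_le.1 (Real.exp_bound (hy.trans hc) (n := 4) (by norm_num))).2
  simp only [Finset.sum_range_succ, Finset.sum_range_zero, Nat.factorial] at taylor
  norm_num at taylor
  have h2 : |y| ^ 2 ≤ c ^ 2 := by gcongr
  have h3 : |y| ^ 3 ≤ c ^ 3 := by gcongr
  have h4 : |y| ^ 4 ≤ c ^ 4 := by gcongr
  have hy3 : y ^ 3 ≤ |y| ^ 3 := by
    rw [← abs_pow]
    exact le_abs_self _
  have hgeom : c ^ 2 / 2 + c ^ 3 / 6 + c ^ 4 / 18 ≤ c ^ 2 / 2 / (1 - c / 3) := by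
    rw [le_div_iff₀ (by linarith)]
    nlinarith [pow_nonneg hc0 5]
  rw [sq_abs] at h2
  have hc4 : 0 ≤ c ^ 4 := by positivity
  linarith

/-- A process with constant start and bounded increments is bounded at each time. -/
theorem exists_ae_abs_le_of_increments_bounded {Ω : Type*} [MeasurableSpace Ω] {P : Measure Ω}
    {Z : ℕ → Ω → ℝ} {z δ : ℝ} (hstart : ∀ᵐ x ∂P, Z 0 x = z)
    (hstep : ∀ t : ℕ, ∀ᵐ x ∂P, |Z (t + 1) x - Z t x| ≤ δ) (t : ℕ) :
    ∃ C, ∀ᵐ x ∂P, |Z t x| ≤ C := by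
  induction t with
  | zero => exact ⟨|z|, hstart.mono fun x hx => by rw [hx]⟩
  | succ t ih =>
    obtain ⟨C, hC⟩ := ih
    refine ⟨C + δ, ?_⟩
    filter_upwards [hC, hstep t] with x h1 h2
    rw [abs_le] at *
    constructor <;> linarith

/-- If the conditional expectation of `X` is at most `b` wherever the nonnegative `m`-measurable
weight `W` is nonzero, then `∫ W X ≤ ∫ W b`. -/
theorem integral_mul_le_of_condExp_le {Ω : Type*} {m m0 : MeasurableSpace Ω} {P : Measure Ω}
    [IsFiniteMeasure P] (hm : m ≤ m0) {W X : Ω → ℝ} {b : ℝ} (hW : StronglyMeasurable[m] W)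
    (hW0 : ∀ x, 0 ≤ W x) (hWi : Integrable W P) (hX : Integrable X P)
    (hWX : Integrable (W * X) P) (hb : ∀ᵐ x ∂P, W x ≠ 0 → (P[X | m]) x ≤ b) :
    ∫ x, W x * X x ∂P ≤ ∫ x, W x * b ∂P := by
  have hpull := condExp_mul_of_stronglyMeasurable_left hW hWX hX
  calc ∫ x, W x * X x ∂P = ∫ x, (P[W * X | m]) x ∂P := (integral_condExp hm).symm
    _ ≤ ∫ x, W x * b ∂P := by
      refine integral_mono_ae integrable_condExp (hWi.mul_const b) ?_
      filter_upwards [hpull, hb] with x h1 h2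
      rw [h1, Pi.mul_apply]
      by_cases h : W x = 0
      · simp [h]
      · exact mul_le_mul_of_nonneg_left (h2 h) (hW0 x)

/-- Let `Z(t)` be a real-valued process with `Z(0) = z₀` a.s., increments
bounded by `δmax`, and conditional drift at most `−β` (given the past `Z(0),…,Z(t)`)
on the event `{Z(t) ≥ θ}`, where `0 < β ≤ δmax`.  With `r = β/(δmax² + δmax β/3)` and
`ρ = 1 − rβ/2`, for every `t`:
`E[e^{r Z(t+1)}] ≤ ρ E[e^{r Z(t)}] + (e^{r δmax} − ρ) e^{r θ}`. -/
theorem stmt2 {Ωs : Type*} [MeasurableSpace Ωs] (P : Measure Ωs) [IsProbabilityMeasure P]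
    (Z : ℕ → Ωs → ℝ) (z0 θ δmax β r ρ : ℝ)
    (hmeas : ∀ t, Measurable (Z t))
    (hZ0 : ∀ᵐ x ∂P, Z 0 x = z0)
    (hδ : 0 < δmax) (hβ : 0 < β) (hβδ : β ≤ δmax)
    (hbdd : ∀ t : ℕ, ∀ᵐ x ∂P, |Z (t + 1) x - Z t x| ≤ δmax)
    (hdrift : ∀ t : ℕ, ∀ᵐ x ∂P, θ ≤ Z t x →
      (P[fun y => Z (t + 1) y - Z t y |
        ⨆ i ∈ Finset.range (t + 1), MeasurableSpace.comap (Z i) inferInstance]) x ≤ -β)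
    (hr : r = β / (δmax ^ 2 + δmax * β / 3)) (hρ : ρ = 1 - r * β / 2) :
    ∀ t : ℕ, ∫ x, Real.exp (r * Z (t + 1) x) ∂P ≤
      ρ * ∫ x, Real.exp (r * Z t x) ∂P + (Real.exp (r * δmax) - ρ) * Real.exp (r * θ) := by
  intro t
  have hD : 0 < δmax ^ 2 + δmax * β / 3 := by positivity
  have hr0 : 0 < r := hr ▸ div_pos hβ hD
  have hrD : r * (δmax ^ 2 + δmax * β / 3) = β := by rw [hr]; field_simp
  have hrδ1 : r * δmax ≤ 1 := by
    have : r * δmax * (δmax + β / 3) ≤ 1 * (δmax + β / 3) := by linarith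
    exact le_of_mul_le_mul_right this (by positivity)
  have hbern : (r * δmax) ^ 2 / 2 / (1 - r * δmax / 3) = r * β / 2 := by
    rw [div_eq_iff (by linarith)]
    linear_combination (r / 2) * hrD
  have hρexp : 0 ≤ Real.exp (r * δmax) - ρ := by
    have h1 : 1 ≤ Real.exp (r * δmax) := Real.one_le_exp (by positivity)
    have h2 : 0 < r * β := by positivity
    linarith
  have hexp_int : ∀ s, Integrable (fun x => Real.exp (r * Z s x)) P := by
    intro s
    obtain ⟨C, hC⟩ := exists_ae_abs_le_of_increments_bounded hZ0 hbdd s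
    refine Integrable.of_bound ((hmeas s).const_mul r).exp.aestronglyMeasurable
      (Real.exp (r * C)) ?_
    filter_upwards [hC] with x hx
    rw [Real.norm_eq_abs, Real.abs_exp]
    gcongr
    exact (abs_le.1 hx).2
  set W : Ωs → ℝ := (Z t ⁻¹' Set.Ici θ).indicator fun x => Real.exp (r * Z t x)
  have hWi : Integrable W P := (hexp_int t).indicator (hmeas t measurableSet_Ici)
  have hW0 : ∀ x, 0 ≤ W x := fun x => Set.indicator_nonneg (fun _ _ => (Real.exp_pos _).le) x
  set X : Ωs → ℝ := fun y => Z (t + 1) y - Z t y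
  have hXm : AEStronglyMeasurable X P := ((hmeas (t + 1)).sub (hmeas t)).aestronglyMeasurable
  have hX : Integrable X P := Integrable.of_bound hXm δmax (hbdd t)
  have hWX : Integrable (fun x => W x * X x) P := hWi.mul_bdd hXm (hbdd t)
  have hcond : ∫ x, W x * X x ∂P ≤ ∫ x, W x * -β ∂P := by
    have hm : ⨆ i ∈ Finset.range (t + 1), MeasurableSpace.comap (Z i) inferInstance ≤
        ‹MeasurableSpace Ωs› := iSup₂_le fun i _ => (hmeas i).comap_le
    have hZm : Measurable[⨆ i ∈ Finset.range (t + 1),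
        MeasurableSpace.comap (Z i) inferInstance] (Z t) :=
      Measurable.of_comap_le (le_iSup₂_of_le t (Finset.self_mem_range_succ t) le_rfl)
    have hWm := ((hZm.const_mul r).exp.indicator
      (hZm (measurableSet_Ici (a := θ)))).stronglyMeasurable
    refine integral_mul_le_of_condExp_le hm hWm hW0 hWi hX hWX ?_
    filter_upwards [hdrift t] with x hx hne
    exact hx (Set.mem_of_indicator_ne_zero (s := Z t ⁻¹' Set.Ici θ) hne)
  have hpoint : ∀ᵐ x ∂P, Real.exp (r * Z (t + 1) x) ≤
      ρ * Real.exp (r * Z t x) + r * (W x * X x - W x * -β)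
        + (Real.exp (r * δmax) - ρ) * Real.exp (r * θ) := by
    filter_upwards [hbdd t] with x hx
    have hsplit : Real.exp (r * Z (t + 1) x) = Real.exp (r * Z t x) * Real.exp (r * X x) := by
      rw [← Real.exp_add, ← mul_add, add_sub_cancel]
    rw [hsplit]
    by_cases hA : θ ≤ Z t x
    · have hWx : W x = Real.exp (r * Z t x) := Set.indicator_of_mem (s := Z t ⁻¹' Set.Ici θ) hA _
      have habs : |r * X x| ≤ r * δmax := by
        rw [abs_mul, abs_of_pos hr0]
        exact mul_le_mul_of_nonneg_left hx hr0.le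
      have hexp := exp_le_one_add_add_of_abs_le habs hrδ1
      rw [hbern] at hexp
      have hmul := mul_le_mul_of_nonneg_left hexp (Real.exp_pos (r * Z t x)).le
      have hrest := mul_nonneg hρexp (Real.exp_pos (r * θ)).le
      rw [hWx]
      linear_combination hmul + hrest - Real.exp (r * Z t x) * hρ
    · have hWx : W x = 0 := Set.indicator_of_notMem (s := Z t ⁻¹' Set.Ici θ) hA _
      have h1 : Real.exp (r * X x) ≤ Real.exp (r * δmax) := by
        gcongr
        exact (abs_le.1 hx).2
      have h2 : Real.exp (r * Z t x) ≤ Real.exp (r * θ) := by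
        gcongr
        exact (not_le.1 hA).le
      have h3 := mul_le_mul_of_nonneg_left h1 (Real.exp_pos (r * Z t x)).le
      have h4 := mul_le_mul_of_nonneg_left h2 hρexp
      rw [hWx]
      linarith
  have hV := (hexp_int t).const_mul ρ
  have hWβ : Integrable (fun x => W x * -β) P := hWi.mul_const _
  have hdiff : Integrable (fun x => r * (W x * X x - W x * -β)) P := (hWX.sub hWβ).const_mul r
  have hsum : Integrable (fun x => ρ * Real.exp (r * Z t x) + r * (W x * X x - W x * -β)) P :=
    hV.add hdiff
  have hint := integral_mono_ae (hexp_int (t + 1)) (hsum.add (integrable_const _)) hpoint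
  have heval : ∫ x, (ρ * Real.exp (r * Z t x) + r * (W x * X x - W x * -β)
        + (Real.exp (r * δmax) - ρ) * Real.exp (r * θ)) ∂P =
      ρ * ∫ x, Real.exp (r * Z t x) ∂P + r * (∫ x, W x * X x ∂P - ∫ x, W x * -β ∂P)
        + (Real.exp (r * δmax) - ρ) * Real.exp (r * θ) := by
    rw [integral_add hsum (integrable_const _), integral_add hV hdiff,
      integral_const_mul, integral_const_mul, integral_sub hWX hWβ]
    simp
  have hneg := mul_nonpos_of_nonneg_of_nonpos hr0.le (sub_nonpos.2 hcond)
  exact (hint.trans_eq heval).trans (by linarith)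
end

section
/- If in addition z₀ ≤ θ, then for any real c > 0 and any integer t > 0, (1/t) Σ_{τ=0}^{t−1} P[Z(τ) ≥ θ + c] ≤ e^{−rc} (e^{r δ_max} − ρ + 1/t)/(1 − ρ). -/
open MeasureTheory

/-- A Bernstein-type upper bound for the exponential on `[-a, a]`, `a ≤ 1`. -/
theorem exp_le_one_add_add_div {a y : ℝ} (ha : a ≤ 1) (hy : |y| ≤ a) :
    Real.exp y ≤ 1 + y + a ^ 2 / 2 / (1 - a / 3) := by
  have h0 : 0 ≤ a := (abs_nonneg y).trans hy
  have h := (abs_le.1 (Real.exp_bound (hy.trans ha) (n := 4) (by norm_num))).2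
  norm_num [Finset.sum_range_succ, Nat.factorial] at h
  have h2 : y ^ 2 ≤ a ^ 2 := sq_le_sq' (abs_le.1 hy).1 (abs_le.1 hy).2
  have h3 : y ^ 3 ≤ a ^ 3 := by
    calc y ^ 3 ≤ |y ^ 3| := le_abs_self _
      _ = |y| ^ 3 := abs_pow y 3
      _ ≤ a ^ 3 := by gcongr
  have h4 : |y| ^ 4 ≤ a ^ 4 := by gcongr
  have h5 : a ^ 2 / 2 + a ^ 3 / 6 + a ^ 4 / 18 ≤ a ^ 2 / 2 / (1 - a / 3) := by
    rw [le_div_iff₀ (by linarith)]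
    nlinarith [pow_nonneg h0 5]
  have h6 : 0 ≤ a ^ 4 := by positivity
  linarith

/-- If `X` has conditional mean at most `-β` on the `m`-measurable set `A`, then a nonnegative
bounded `m`-measurable weight `G` supported on `A` satisfies `E[G X] ≤ -β E[G]`. -/
theorem integral_mul_le_of_condExp_le_s5 {Ω : Type*} {m m0 : MeasurableSpace Ω} (hm : m ≤ m0)
    {P : Measure Ω} [IsProbabilityMeasure P] {A : Set Ω} {G X : Ω → ℝ} {β : ℝ}
    (hG : StronglyMeasurable[m] G) (hGi : Integrable G P) (hX : Integrable X P)
    (hGX : Integrable (G * X) P) (hG0 : ∀ x, 0 ≤ G x) (hGA : ∀ x, x ∉ A → G x = 0)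
    (hA : ∀ᵐ x ∂P, x ∈ A → (P[X | m]) x ≤ -β) :
    ∫ x, G x * X x ∂P ≤ -β * ∫ x, G x ∂P := by
  have hpull : P[G * X | m] =ᵐ[P] G * P[X | m] :=
    condExp_mul_of_stronglyMeasurable_left hG hGX hX
  calc ∫ x, G x * X x ∂P = ∫ x, (P[G * X | m]) x ∂P := (integral_condExp hm).symm
    _ ≤ ∫ x, -β * G x ∂P := by
      refine integral_mono_ae integrable_condExp (hGi.const_mul _) ?_
      filter_upwards [hpull, hA] with x h1 h2
      rw [h1, Pi.mul_apply]
      by_cases hx : x ∈ A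
      · nlinarith [hG0 x, h2 hx]
      · simp [hGA x hx]
    _ = -β * ∫ x, G x ∂P := integral_const_mul _ _

/-- One-step drift of the exponential moment: if `W` has steps `X` bounded by `δ` with conditional
mean at most `-β` on `{0 ≤ W}`, and `e^{ry} ≤ ρ + r(y + β)` on `[-δ, δ]`, then
`E[e^{r(W + X)}] ≤ ρ E[e^{rW}] + (e^{rδ} - ρ)`. -/
theorem integral_exp_add_le {Ω : Type*} {m m0 : MeasurableSpace Ω} (hm : m ≤ m0)
    {P : Measure Ω} [IsProbabilityMeasure P] {W X : Ω → ℝ} {β δ r ρ : ℝ}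
    (hW : Measurable[m] W) (hX : Measurable X)
    (hYi : Integrable (fun x => Real.exp (r * W x)) P)
    (hYi' : Integrable (fun x => Real.exp (r * (W x + X x))) P)
    (hXδ : ∀ᵐ x ∂P, |X x| ≤ δ)
    (hdrift : ∀ᵐ x ∂P, 0 ≤ W x → (P[X | m]) x ≤ -β)
    (hr : 0 ≤ r) (hρ : ρ ≤ Real.exp (r * δ))
    (hexp : ∀ y, |y| ≤ δ → Real.exp (r * y) ≤ ρ + r * (y + β)) :
    ∫ x, Real.exp (r * (W x + X x)) ∂P ≤
      ρ * ∫ x, Real.exp (r * W x) ∂P + (Real.exp (r * δ) - ρ) := by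
  have hA : MeasurableSet[m] {x | 0 ≤ W x} := hW measurableSet_Ici
  set G : Ω → ℝ := {x | 0 ≤ W x}.indicator fun x => Real.exp (r * W x)
  have hGm : Measurable[m] G :=
    Measurable.indicator (Real.measurable_exp.comp (hW.const_mul r)) hA
  have hGi : Integrable G P := hYi.indicator (hm _ hA)
  have hXb : ∀ᵐ x ∂P, ‖X x‖ ≤ δ := hXδ
  have hXi : Integrable X P := Integrable.of_bound hX.aestronglyMeasurable δ hXb
  have hGX : Integrable (G * X) P := hGi.mul_bdd hX.aestronglyMeasurable hXb
  have key : ∫ x, G x * X x ∂P ≤ -β * ∫ x, G x ∂P :=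
    integral_mul_le_of_condExp_le_s5 hm hGm.stronglyMeasurable hGi hXi hGX
      (fun x => Set.indicator_nonneg (fun _ _ => (Real.exp_pos _).le) x)
      (fun x hx => Set.indicator_of_notMem hx _) hdrift
  have hL : Integrable (fun x => ρ * Real.exp (r * W x) + (Real.exp (r * δ) - ρ)) P :=
    (hYi.const_mul ρ).add (integrable_const _)
  have hGXr : Integrable (fun x => r * (G x * X x)) P := hGX.const_mul r
  have hR : Integrable (fun x => r * (G x * X x) + r * β * G x) P :=
    hGXr.add (hGi.const_mul (r * β))
  calc ∫ x, Real.exp (r * (W x + X x)) ∂P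
      ≤ ∫ x, ((ρ * Real.exp (r * W x) + (Real.exp (r * δ) - ρ)) +
          (r * (G x * X x) + r * β * G x)) ∂P := by
        refine integral_mono_ae hYi' (hL.add hR) ?_
        filter_upwards [hXδ] with x hx
        have hpos := Real.exp_pos (r * W x)
        have hsplit : Real.exp (r * (W x + X x)) = Real.exp (r * W x) * Real.exp (r * X x) := by
          rw [mul_add, Real.exp_add]
        change Real.exp (r * (W x + X x)) ≤ _
        rw [hsplit]
        by_cases h : 0 ≤ W x
        · have hGx : G x = Real.exp (r * W x) := Set.indicator_of_mem (s := {x | 0 ≤ W x}) h _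
          rw [hGx]
          nlinarith [mul_le_mul_of_nonneg_left (hexp _ hx) hpos.le]
        · have hGx : G x = 0 := Set.indicator_of_notMem (s := {x | 0 ≤ W x}) h _
          have h1 : Real.exp (r * W x) ≤ 1 :=
            Real.exp_le_one_iff.2 (mul_nonpos_of_nonneg_of_nonpos hr (not_le.1 h).le)
          have h2 : Real.exp (r * X x) ≤ Real.exp (r * δ) :=
            Real.exp_le_exp.2 (mul_le_mul_of_nonneg_left ((le_abs_self _).trans hx) hr)
          rw [hGx]
          nlinarith [mul_le_mul_of_nonneg_left h2 hpos.le]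
    _ = (ρ * ∫ x, Real.exp (r * W x) ∂P + (Real.exp (r * δ) - ρ)) +
          (r * ∫ x, G x * X x ∂P + r * β * ∫ x, G x ∂P) := by
        rw [integral_add hL hR, integral_add (hYi.const_mul ρ) (integrable_const _),
          integral_add hGXr (hGi.const_mul (r * β))]
        simp [integral_const_mul]
    _ ≤ _ := by nlinarith [mul_le_mul_of_nonneg_left key hr]

/-- Summing the affine recursion `a (n + 1) ≤ ρ a n + D` with `a ≥ 0`. -/
theorem one_sub_mul_sum_range_le {a : ℕ → ℝ} {ρ D : ℝ} (ha : ∀ n, 0 ≤ a n)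
    (h : ∀ n, a (n + 1) ≤ ρ * a n + D) (t : ℕ) :
    (1 - ρ) * ∑ n ∈ Finset.range t, a n ≤ t * D + a 0 := by
  suffices hs : (1 - ρ) * ∑ n ∈ Finset.range t, a n ≤ t * D + a 0 - a t by linarith [ha t]
  induction t with
  | zero => simp
  | succ n ih =>
    rw [Finset.sum_range_succ]
    push_cast
    linarith [h n]

/-- Under the drift assumptions, if in addition `z₀ ≤ θ`, then for any real
`c > 0` and any integer `t > 0`,
`(1/t) Σ_{τ=0}^{t−1} P[Z(τ) ≥ θ + c] ≤ e^{−rc} (e^{r δmax} − ρ + 1/t)/(1 − ρ)`. -/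
theorem stmt5 {Ωs : Type*} [MeasurableSpace Ωs] (P : Measure Ωs) [IsProbabilityMeasure P]
    (Z : ℕ → Ωs → ℝ) (z0 θ δmax β r ρ : ℝ)
    (hmeas : ∀ t, Measurable (Z t))
    (hZ0 : ∀ᵐ x ∂P, Z 0 x = z0)
    (hδ : 0 < δmax) (hβ : 0 < β) (hβδ : β ≤ δmax)
    (hbdd : ∀ t : ℕ, ∀ᵐ x ∂P, |Z (t + 1) x - Z t x| ≤ δmax)
    (hdrift : ∀ t : ℕ, ∀ᵐ x ∂P, θ ≤ Z t x →
      (P[fun y => Z (t + 1) y - Z t y |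
        ⨆ i ∈ Finset.range (t + 1), MeasurableSpace.comap (Z i) inferInstance]) x ≤ -β)
    (hr : r = β / (δmax ^ 2 + δmax * β / 3)) (hρ : ρ = 1 - r * β / 2)
    (hz0θ : z0 ≤ θ) :
    ∀ c : ℝ, 0 < c → ∀ t : ℕ, 0 < t →
      (1 / (t : ℝ)) * ∑ τ ∈ Finset.range t, (P {x | θ + c ≤ Z τ x}).toReal ≤
        Real.exp (-(r * c)) * (Real.exp (r * δmax) - ρ + 1 / t) / (1 - ρ) := by
  intro c hc t ht
  have hδβ : 0 < δmax + β / 3 := by positivity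
  have hr' : r = β / (δmax * (δmax + β / 3)) := by rw [hr]; congr 1; ring
  have hrpos : 0 < r := by rw [hr']; positivity
  have hrδ : r * δmax = β / (δmax + β / 3) := by rw [hr']; field_simp
  have hρ1 : ρ < 1 := by rw [hρ]; nlinarith [mul_pos hrpos hβ]
  have hrδ1 : r * δmax ≤ 1 := by rw [hrδ, div_le_one hδβ]; linarith
  have hquad : (r * δmax) ^ 2 / 2 / (1 - r * δmax / 3) = r * β / 2 := by
    have h1 : 1 - r * δmax / 3 = δmax / (δmax + β / 3) := by
      rw [hrδ]; field_simp; ring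
    rw [h1, hrδ, hr']
    field_simp
  have hexp : ∀ y, |y| ≤ δmax → Real.exp (r * y) ≤ ρ + r * (y + β) := by
    intro y hy
    have h := exp_le_one_add_add_div (y := r * y) hrδ1
      (by rw [abs_mul, abs_of_pos hrpos]; gcongr)
    rw [hquad] at h
    rw [hρ]
    linarith
  have hbound : ∀ n : ℕ, ∀ᵐ x ∂P, Z n x ≤ z0 + n * δmax := by
    intro n
    induction n with
    | zero => filter_upwards [hZ0] with x hx; simp [hx]
    | succ n ih =>
      filter_upwards [ih, hbdd n] with x h1 h2
      push_cast
      linarith [(abs_le.1 h2).2]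
  have hint : ∀ n : ℕ, Integrable (fun x => Real.exp (r * (Z n x - θ))) P := by
    intro n
    refine Integrable.of_bound (((hmeas n).sub_const θ).const_mul r).exp.aestronglyMeasurable
      (Real.exp (r * (z0 + n * δmax - θ))) ?_
    filter_upwards [hbound n] with x hx
    rw [Real.norm_eq_abs, Real.abs_exp]
    gcongr
  have hstep : ∀ n : ℕ, ∫ x, Real.exp (r * (Z (n + 1) x - θ)) ∂P ≤
      ρ * ∫ x, Real.exp (r * (Z n x - θ)) ∂P + (Real.exp (r * δmax) - ρ) := by
    intro n
    have hm : (⨆ i ∈ Finset.range (n + 1), MeasurableSpace.comap (Z i) inferInstance) ≤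
        ‹MeasurableSpace Ωs› := iSup₂_le fun i _ => (hmeas i).comap_le
    have hZm : Measurable[⨆ i ∈ Finset.range (n + 1),
        MeasurableSpace.comap (Z i) inferInstance] (Z n) :=
      Measurable.mono (comap_measurable (Z n))
        (le_iSup₂_of_le n (Finset.self_mem_range_succ n) le_rfl) le_rfl
    have heq : ∀ x, Z n x - θ + (Z (n + 1) x - Z n x) = Z (n + 1) x - θ := fun x => by ring
    have h := integral_exp_add_le (P := P) hm (W := fun x => Z n x - θ)
      (X := fun x => Z (n + 1) x - Z n x) (β := β) (δ := δmax) (r := r) (ρ := ρ)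
      (hZm.sub_const θ) ((hmeas _).sub (hmeas _)) (hint n)
      (by simpa only [heq] using hint (n + 1)) (hbdd n)
      (by simpa only [sub_nonneg] using hdrift n) hrpos.le
      (hρ1.le.trans (Real.one_le_exp (by positivity))) hexp
    simpa only [heq] using h
  have hinit : ∫ x, Real.exp (r * (Z 0 x - θ)) ∂P ≤ 1 := by
    calc ∫ x, Real.exp (r * (Z 0 x - θ)) ∂P ≤ ∫ _, (1 : ℝ) ∂P := by
          refine integral_mono_ae (hint 0) (integrable_const _) ?_
          filter_upwards [hZ0] with x hx
          refine Real.exp_le_one_iff.2 (mul_nonpos_of_nonneg_of_nonpos hrpos.le ?_)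
          rw [hx]
          linarith
      _ = 1 := by simp
  have hmarkov : ∀ n : ℕ, (P {x | θ + c ≤ Z n x}).toReal ≤
      Real.exp (-(r * c)) * ∫ x, Real.exp (r * (Z n x - θ)) ∂P := by
    intro n
    have h := mul_meas_ge_le_integral_of_nonneg
      (Filter.Eventually.of_forall fun x => (Real.exp_pos _).le) (hint n) (Real.exp (r * c))
    have hset : {x | Real.exp (r * c) ≤ Real.exp (r * (Z n x - θ))} = {x | θ + c ≤ Z n x} := by
      ext x
      simp only [Set.mem_ofPred_eq, Real.exp_le_exp, mul_le_mul_iff_right₀ hrpos]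
      exact le_sub_iff_add_le'
    rw [hset, measureReal_def] at h
    rwa [Real.exp_neg, inv_mul_eq_div, le_div_iff₀' (Real.exp_pos _)]
  have hsum := one_sub_mul_sum_range_le (a := fun n => ∫ x, Real.exp (r * (Z n x - θ)) ∂P)
    (fun n => integral_nonneg fun x => (Real.exp_pos _).le) hstep t
  have ht' : (0 : ℝ) < t := Nat.cast_pos.2 ht
  have h1ρ : 0 < 1 - ρ := sub_pos.2 hρ1
  calc (1 / (t : ℝ)) * ∑ τ ∈ Finset.range t, (P {x | θ + c ≤ Z τ x}).toReal
      ≤ (1 / (t : ℝ)) * (Real.exp (-(r * c)) *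
          ∑ τ ∈ Finset.range t, ∫ x, Real.exp (r * (Z τ x - θ)) ∂P) := by
        gcongr
        rw [Finset.mul_sum]
        exact Finset.sum_le_sum fun τ _ => hmarkov τ
    _ ≤ (1 / (t : ℝ)) * (Real.exp (-(r * c)) *
          ((t * (Real.exp (r * δmax) - ρ) + 1) / (1 - ρ))) := by
        gcongr
        rw [le_div_iff₀' h1ρ]
        linarith
    _ = _ := by field_simp
end

section
/- Suppose in addition there is a real s > 0 with z₀ − c ≤ s, and let T be the smallest integer greater than or equal to r·s/log(1/ρ). Then for every integer t > T, (1/t) Σ_{τ=0}^{t−1} P[Z(τ) > c] ≤ (e^{r δ_max} − ρ) e^{−rc}/(1 − ρ) + (T + 1/(1 − ρ))/t. -/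
open MeasureTheory

theorem Real.exp_le_one_add_add_of_abs_le {x b : ℝ} (hx : |x| ≤ b) (hb : b ≤ 1) :
    Real.exp x ≤ 1 + x + b ^ 2 / (2 * (1 - b / 3)) := by
  have h := (abs_le.1 (Real.exp_bound (hx.trans hb) (n := 4) (by norm_num))).2
  norm_num [Finset.sum_range_succ, Nat.factorial] at h
  have hy := abs_nonneg x
  have h2 : x ^ 2 ≤ b ^ 2 := by rw [← sq_abs]; gcongr
  have h3 : x ^ 3 ≤ b ^ 3 := by
    calc x ^ 3 ≤ |x| ^ 3 := by rw [← abs_pow]; exact le_abs_self _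
      _ ≤ b ^ 3 := by gcongr
  have h4 : |x| ^ 4 ≤ b ^ 4 := by gcongr
  have hb0 : 0 ≤ b := hy.trans hx
  have key : b ^ 2 / 2 + b ^ 3 / 6 + b ^ 4 * (5 / 96) ≤ b ^ 2 / (2 * (1 - b / 3)) := by
    rw [le_div_iff₀ (by linarith)]
    nlinarith [pow_nonneg hb0 4, pow_nonneg hb0 5]
  linarith

/-- One step of the exponential drift recursion. -/
theorem integral_exp_le_of_condExp_drift {Ω : Type*} {m m0 : MeasurableSpace Ω}
    {P : Measure Ω} [IsProbabilityMeasure P] (hm : m ≤ m0) {X Y : Ω → ℝ} {r ρ δ β C : ℝ}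
    (hX : Measurable[m] X) (hY : Measurable Y) (hr : 0 ≤ r) (hρ : ρ ≤ Real.exp (r * δ))
    (hexp : ∀ d, |d| ≤ δ → Real.exp (r * d) ≤ ρ + r * (d + β))
    (hC : ∀ᵐ x ∂P, |X x| ≤ C) (hbdd : ∀ᵐ x ∂P, |Y x - X x| ≤ δ)
    (hdrift : ∀ᵐ x ∂P, 0 < X x → (P[fun y => Y y - X y | m]) x ≤ -β) :
    ∫ x, Real.exp (r * Y x) ∂P ≤ ρ * ∫ x, Real.exp (r * X x) ∂P + (Real.exp (r * δ) - ρ) := by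
  have hX0 : Measurable X := hX.mono hm le_rfl
  have hexpX : Integrable (fun x => Real.exp (r * X x)) P := by
    refine Integrable.of_bound (by fun_prop) (Real.exp (r * C)) ?_
    filter_upwards [hC] with x hx
    rw [Real.norm_eq_abs, Real.abs_exp]
    gcongr
    exact (le_abs_self _).trans hx
  have hexpY : Integrable (fun x => Real.exp (r * Y x)) P := by
    refine Integrable.of_bound (by fun_prop) (Real.exp (r * (C + δ))) ?_
    filter_upwards [hC, hbdd] with x hx hd
    rw [Real.norm_eq_abs, Real.abs_exp]
    gcongr
    linarith [(abs_le.1 hx).2, (abs_le.1 hd).2]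
  set g : Ω → ℝ := {x | 0 < X x}.indicator (fun x => Real.exp (r * X x)) with hg
  have hA : MeasurableSet[m] {x | 0 < X x} := hX measurableSet_Ioi
  have hgm : Measurable[m] g :=
    Measurable.indicator (Real.measurable_exp.comp (hX.const_mul r)) hA
  have hgi : Integrable g P := hexpX.indicator (hm _ hA)
  have hg0 : ∀ x, 0 ≤ g x := fun x => Set.indicator_nonneg (fun _ _ => (Real.exp_pos _).le) x
  have hD : Integrable (fun x => Y x - X x) P :=
    Integrable.of_bound (by fun_prop) δ hbdd
  have hgD : Integrable (fun x => g x * (Y x - X x)) P :=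
    hgi.mul_bdd (by fun_prop) hbdd
  have hint : ∫ x, g x * (Y x - X x) ∂P ≤ ∫ x, g x * (-β) ∂P := by
    have hpull := condExp_mul_of_stronglyMeasurable_left (μ := P) hgm.stronglyMeasurable
      (g := fun x => Y x - X x) hgD hD
    calc ∫ x, g x * (Y x - X x) ∂P
        = ∫ x, (P[fun x => g x * (Y x - X x) | m]) x ∂P := (integral_condExp hm).symm
      _ ≤ ∫ x, g x * (-β) ∂P := by
        refine integral_mono_ae integrable_condExp (hgi.mul_const _) ?_
        filter_upwards [hpull, hdrift] with x hx hd
        refine hx.le.trans ?_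
        by_cases h : 0 < X x
        · exact mul_le_mul_of_nonneg_left (hd h) (hg0 x)
        · have : g x = 0 := Set.indicator_of_notMem (s := {x | 0 < X x}) h _
          simp [this]
  have hpt : ∀ᵐ x ∂P, Real.exp (r * Y x) ≤ ρ * Real.exp (r * X x) + (Real.exp (r * δ) - ρ)
      + r * (g x * (Y x - X x) - g x * (-β)) := by
    filter_upwards [hbdd] with x hd
    have hY' : Real.exp (r * Y x) = Real.exp (r * X x) * Real.exp (r * (Y x - X x)) := by
      rw [← Real.exp_add]; ring_nf
    have hp := Real.exp_pos (r * X x)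
    by_cases h : 0 < X x
    · have hgx : g x = Real.exp (r * X x) := Set.indicator_of_mem (s := {x | 0 < X x}) h _
      have := mul_le_mul_of_nonneg_left (hexp _ hd) hp.le
      rw [hY', hgx]
      linarith
    · have hgx : g x = 0 := Set.indicator_of_notMem (s := {x | 0 < X x}) h _
      have h1 : Real.exp (r * X x) ≤ 1 :=
        Real.exp_le_one_iff.2 (mul_nonpos_of_nonneg_of_nonpos hr (not_lt.1 h))
      have h2 : Real.exp (r * (Y x - X x)) ≤ Real.exp (r * δ) := by
        gcongr
        exact (le_abs_self _).trans hd
      rw [hY', hgx]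
      nlinarith
  have h1 : Integrable (fun x => ρ * Real.exp (r * X x) + (Real.exp (r * δ) - ρ)) P :=
    (hexpX.const_mul _).add (integrable_const _)
  have h2 : Integrable (fun x => r * (g x * (Y x - X x) - g x * (-β))) P :=
    (hgD.sub (hgi.mul_const _)).const_mul _
  have h3 := integral_mono_ae hexpY (h1.add h2) hpt
  rw [integral_add' h1 h2, integral_add (hexpX.const_mul _) (integrable_const _),
    integral_const_mul, integral_const_mul, integral_sub hgD (hgi.mul_const _)] at h3
  simp only [integral_const, probReal_univ, one_smul] at h3
  nlinarith

theorem ae_abs_le_of_ae_abs_sub_le {Ω : Type*} [MeasurableSpace Ω] {P : Measure Ω}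
    {Z : ℕ → Ω → ℝ} {z δ : ℝ} (h0 : ∀ᵐ x ∂P, Z 0 x = z)
    (hbdd : ∀ t : ℕ, ∀ᵐ x ∂P, |Z (t + 1) x - Z t x| ≤ δ) (t : ℕ) :
    ∀ᵐ x ∂P, |Z t x| ≤ |z| + t * δ := by
  induction t with
  | zero => filter_upwards [h0] with x hx; simp [hx]
  | succ t ih =>
    filter_upwards [ih, hbdd t] with x h1 h2
    have := abs_add_le (Z t x) (Z (t + 1) x - Z t x)
    rw [add_sub_cancel] at this
    push_cast
    linarith

theorem measure_gt_le_exp_mul_integral {Ω : Type*} [MeasurableSpace Ω] {P : Measure Ω}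
    [IsProbabilityMeasure P] {X : Ω → ℝ} {r c C : ℝ} (hX : Measurable X) (hr : 0 ≤ r)
    (hC : ∀ᵐ x ∂P, |X x| ≤ C) :
    (P {x | c < X x}).toReal ≤ Real.exp (-(r * c)) * ∫ x, Real.exp (r * X x) ∂P := by
  have hint : Integrable (fun x => Real.exp (r * X x)) P := by
    refine Integrable.of_bound (by fun_prop) (Real.exp (r * C)) ?_
    filter_upwards [hC] with x hx
    rw [Real.norm_eq_abs, Real.abs_exp]
    gcongr
    exact (le_abs_self _).trans hx
  calc (P {x | c < X x}).toReal ≤ P.real {x | c ≤ X x} :=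
        measureReal_mono (fun x (hx : c < X x) => hx.le)
    _ ≤ _ := by
      have := ProbabilityTheory.measure_ge_le_exp_mul_mgf c hr hint
      rwa [neg_mul] at this

theorem average_le_of_le_geometric {p : ℕ → ℝ} {a ρ D : ℝ} {T t : ℕ} (hρ : 0 ≤ ρ) (hρ1 : ρ < 1)
    (hD : 0 ≤ D) (haT : ρ ^ T * a ≤ 1) (h1 : ∀ τ, p τ ≤ 1) (hp : ∀ τ, p τ ≤ ρ ^ τ * a + D)
    (ht : T < t) :
    (1 / (t : ℝ)) * ∑ τ ∈ Finset.range t, p τ ≤ D + ((T : ℝ) + 1 / (1 - ρ)) / t := by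
  obtain ⟨k, rfl⟩ := Nat.exists_eq_add_of_le ht.le
  have hpos : (0 : ℝ) < (T + k : ℕ) := by exact_mod_cast (Nat.zero_le _).trans_lt ht
  have hA : ∑ τ ∈ Finset.range T, p τ ≤ T := by
    simpa using Finset.sum_le_sum (s := Finset.range T) (fun τ _ => h1 τ)
  have hB : ∑ j ∈ Finset.range k, p (T + j) ≤ 1 / (1 - ρ) + k * D := by
    calc ∑ j ∈ Finset.range k, p (T + j) ≤ ∑ j ∈ Finset.range k, (ρ ^ j + D) := by
          refine Finset.sum_le_sum fun j _ => (hp _).trans ?_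
          have := mul_le_mul_of_nonneg_left haT (pow_nonneg hρ j)
          rw [pow_add]
          linarith
      _ = ∑ j ∈ Finset.range k, ρ ^ j + k * D := by simp [Finset.sum_add_distrib]
      _ ≤ _ := by
        gcongr
        rw [one_div, ← tsum_geometric_of_lt_one hρ hρ1]
        exact (summable_geometric_of_lt_one hρ hρ1).sum_le_tsum _ fun i _ => pow_nonneg hρ i
  have hTD : 0 ≤ (T : ℝ) * D := by positivity
  rw [Finset.sum_range_add, one_div, inv_mul_le_iff₀ hpos, mul_add, mul_div_cancel₀ _ hpos.ne']
  push_cast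
  linarith

/-- Under the assumptions of Statement 7 (drift `−β` on `{Z(t) > 0}`),
suppose in addition there is a real `s > 0` with `z₀ − c ≤ s`, and let `T` be the
smallest integer greater than or equal to `r·s/log(1/ρ)`.  Then for every integer `t > T`:
`(1/t) Σ_{τ=0}^{t−1} P[Z(τ) > c]
  ≤ (e^{r δmax} − ρ) e^{−rc}/(1 − ρ) + (T + 1/(1 − ρ))/t`. -/
theorem stmt8 {Ωs : Type*} [MeasurableSpace Ωs] (P : Measure Ωs) [IsProbabilityMeasure P]
    (Z : ℕ → Ωs → ℝ) (z0 δmax β r ρ c s : ℝ)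
    (hmeas : ∀ t, Measurable (Z t))
    (hZ0 : ∀ᵐ x ∂P, Z 0 x = z0)
    (hδ : 0 < δmax) (hβ : 0 < β) (hβδ : β ≤ δmax)
    (hbdd : ∀ t : ℕ, ∀ᵐ x ∂P, |Z (t + 1) x - Z t x| ≤ δmax)
    (hdrift : ∀ t : ℕ, ∀ᵐ x ∂P, 0 < Z t x →
      (P[fun y => Z (t + 1) y - Z t y |
        ⨆ i ∈ Finset.range (t + 1), MeasurableSpace.comap (Z i) inferInstance]) x ≤ -β)
    (hr : r = β / (δmax ^ 2 + δmax * β / 3)) (hρ : ρ = 1 - r * β / 2)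
    (hc : 0 < c) (hs : 0 < s) (hz0s : z0 - c ≤ s)
    (T : ℕ) (hT : T = ⌈r * s / Real.log (1 / ρ)⌉₊) :
    ∀ t : ℕ, T < t →
      (1 / (t : ℝ)) * ∑ τ ∈ Finset.range t, (P {x | c < Z τ x}).toReal ≤
        (Real.exp (r * δmax) - ρ) * Real.exp (-(r * c)) / (1 - ρ) +
          ((T : ℝ) + 1 / (1 - ρ)) / t := by
  intro t ht
  have hden : 0 < δmax ^ 2 + δmax * β / 3 := by positivity
  have hr0 : 0 < r := hr ▸ div_pos hβ hden
  have hrd : r * (δmax ^ 2 + δmax * β / 3) = β := by rw [hr]; exact div_mul_cancel₀ _ hden.ne'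
  have hrδ : r * δmax ≤ 1 := by
    rw [hr, div_mul_eq_mul_div, div_le_one hden]
    nlinarith [mul_pos hδ hβ]
  have hrβ : r * β ≤ 1 := (mul_le_mul_of_nonneg_left hβδ hr0.le).trans hrδ
  have hρ0 : 0 < ρ := by linarith
  have hρ1 : ρ < 1 := by linarith [mul_pos hr0 hβ]
  have hρexp : ρ ≤ Real.exp (r * δmax) :=
    hρ1.le.trans (Real.one_le_exp (mul_pos hr0 hδ).le)
  have hexp : ∀ d, |d| ≤ δmax → Real.exp (r * d) ≤ ρ + r * (d + β) := by
    intro d hd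
    have h1 : |r * d| ≤ r * δmax := by
      rw [abs_mul, abs_of_pos hr0]
      exact mul_le_mul_of_nonneg_left hd hr0.le
    have h2 := Real.exp_le_one_add_add_of_abs_le h1 hrδ
    have h3 : (r * δmax) ^ 2 / (2 * (1 - r * δmax / 3)) = r * β / 2 := by
      rw [div_eq_div_iff (by linarith) two_ne_zero]
      linear_combination 2 * r * hrd
    linarith
  have hC := ae_abs_le_of_ae_abs_sub_le hZ0 hbdd
  set D := (Real.exp (r * δmax) - ρ) / (1 - ρ) with hDdef
  have hD : 0 ≤ D := div_nonneg (by linarith) (by linarith)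
  have hDmul : D * (1 - ρ) = Real.exp (r * δmax) - ρ := div_mul_cancel₀ _ (by linarith)
  have hmgf : ∀ τ, ∫ x, Real.exp (r * Z τ x) ∂P ≤ ρ ^ τ * Real.exp (r * z0) + D := by
    intro τ
    induction τ with
    | zero =>
      have : ∫ x, Real.exp (r * Z 0 x) ∂P = ∫ _, Real.exp (r * z0) ∂P :=
        integral_congr_ae (by filter_upwards [hZ0] with x hx; rw [hx])
      rw [this]
      simpa using hD
    | succ τ ih =>
      have hm : (⨆ i ∈ Finset.range (τ + 1), MeasurableSpace.comap (Z i) inferInstance) ≤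
          (inferInstance : MeasurableSpace Ωs) := iSup₂_le fun i _ => (hmeas i).comap_le
      have hZm : Measurable[⨆ i ∈ Finset.range (τ + 1), MeasurableSpace.comap (Z i) inferInstance]
          (Z τ) := measurable_iff_comap_le.2
        (le_iSup₂_of_le (f := fun i (_ : i ∈ Finset.range (τ + 1)) =>
          MeasurableSpace.comap (Z i) inferInstance) τ (Finset.self_mem_range_succ τ) le_rfl)
      have hstep := integral_exp_le_of_condExp_drift hm hZm (hmeas (τ + 1)) hr0.le hρexp hexp
        (hC τ) (hbdd τ) (hdrift τ)
      have := mul_le_mul_of_nonneg_left ih hρ0.le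
      rw [pow_succ]
      linarith
  have hlog : 0 < Real.log (1 / ρ) := Real.log_pos (by rwa [lt_div_iff₀ hρ0, one_mul])
  have haT : ρ ^ T * Real.exp (r * s) ≤ 1 := by
    have h1 : r * s / Real.log (1 / ρ) ≤ T := hT ▸ Nat.le_ceil _
    rw [div_le_iff₀ hlog, one_div, Real.log_inv] at h1
    rw [← Real.exp_log hρ0, ← Real.exp_nat_mul, ← Real.exp_add, Real.exp_le_one_iff]
    linarith
  rw [mul_div_right_comm]
  refine average_le_of_le_geometric hρ0.le hρ1 (mul_nonneg hD (Real.exp_pos _).le) haT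
    (fun τ => measureReal_le_one) (fun τ => ?_) ht
  refine (measure_gt_le_exp_mul_integral (hmeas τ) hr0.le (hC τ)).trans ?_
  have hshift : Real.exp (-(r * c)) * Real.exp (r * z0) ≤ Real.exp (r * s) := by
    rw [← Real.exp_add, Real.exp_le_exp]
    nlinarith
  have h1 := mul_le_mul_of_nonneg_left (hmgf τ) (Real.exp_pos (-(r * c))).le
  have h2 := mul_le_mul_of_nonneg_left hshift (pow_nonneg hρ0.le τ)
  linarith
end

section
/- Suppose V ≥ ω_M² and the DPP recursion is run with arbitrary nonnegative deterministic sequences a(t) and channel states ω(t) ∈ Ω. Then: (a) for every slot t, if Q(t) < ω_M then p(t) = 0 and μ(t) = 0; and (b) for every slot t, Q(t+1) = Q(t) + a(t) − μ(t), i.e., the max with 0 in the queue update is never active. -/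
/-- Deterministic DPP recursion.  The channel values are
`0 = ωv 0 < ωv 1 < ⋯ < ωv M`, arrivals `a t ≥ 0`, channel states `w t ∈ {ωv 0,…,ωv M}`,
`Q 0 = q₀ ≥ 0`, `p t = 1` iff `Q t · w t ≥ V`, `μ t = p t · w t`, and
`Q (t+1) = max (Q t + a t − μ t) 0`.  If `V ≥ (ωv M)²`, then:
(a) for every `t`, if `Q t < ωv M` then `p t = 0` and `μ t = 0`; and
(b) for every `t`, `Q (t+1) = Q t + a t − μ t`. -/
theorem stmt9 (M : ℕ) (ωv : ℕ → ℝ) (hω0 : ωv 0 = 0)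
    (hmono : ∀ i j : ℕ, i < j → j ≤ M → ωv i < ωv j)
    (a w : ℕ → ℝ) (ha : ∀ t, 0 ≤ a t) (hw : ∀ t, ∃ k ≤ M, w t = ωv k)
    (V q0 : ℝ) (hV : ωv M ^ 2 ≤ V) (hq0 : 0 ≤ q0)
    (Q p μ : ℕ → ℝ)
    (hQ0 : Q 0 = q0)
    (hp : ∀ t, p t = if V ≤ Q t * w t then 1 else 0)
    (hμ : ∀ t, μ t = p t * w t)
    (hQ : ∀ t, Q (t + 1) = max (Q t + a t - μ t) 0) :
    (∀ t, Q t < ωv M → p t = 0 ∧ μ t = 0) ∧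
      (∀ t, Q (t + 1) = Q t + a t - μ t) := by
  have le_top : ∀ k ≤ M, ωv k ≤ ωv M := fun k hk => by
    rcases hk.lt_or_eq with h | rfl
    · exact (hmono k M h le_rfl).le
    · exact le_rfl
  have nonneg : ∀ k ≤ M, 0 ≤ ωv k := fun k hk => by
    rcases k.eq_zero_or_pos with rfl | h
    · exact hω0.ge
    · exact hω0 ▸ (hmono 0 k h hk).le
  have w_nonneg : ∀ t, 0 ≤ w t := fun t => by
    obtain ⟨k, hk, hwk⟩ := hw t
    exact hwk ▸ nonneg k hk
  have w_le : ∀ t, w t ≤ ωv M := fun t => by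
    obtain ⟨k, hk, hwk⟩ := hw t
    exact hwk ▸ le_top k hk
  have Q_nonneg : ∀ t, 0 ≤ Q t
    | 0 => hQ0 ▸ hq0
    | t + 1 => hQ t ▸ le_max_right _ _
  have idle : ∀ t, Q t < ωv M → p t = 0 ∧ μ t = 0 := fun t ht => by
    have hlt : Q t * w t < V := by
      nlinarith [mul_le_mul_of_nonneg_left (w_le t) (Q_nonneg t),
        mul_lt_mul_of_pos_right ht ((Q_nonneg t).trans_lt ht)]
    have hp0 : p t = 0 := by rw [hp, if_neg hlt.not_ge]
    exact ⟨hp0, by rw [hμ, hp0, zero_mul]⟩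
  refine ⟨idle, fun t => ?_⟩
  rw [hQ, max_eq_left]
  rcases lt_or_ge (Q t) (ωv M) with h | h
  · rw [(idle t h).2]
    linarith [ha t, Q_nonneg t]
  · have hμw : μ t ≤ w t := by
      rw [hμ, hp]
      split_ifs
      · rw [one_mul]
      · rw [zero_mul]
        exact w_nonneg t
    linarith [ha t, w_le t]
end

section
/- There exists a constant κ > 0 such that the following holds. For every ε with 0 < ε < 1/64, every integer t ≥ 1, every (μ₀, p₀) ∈ S₁, and every (μ₁, p₁) ∈ R₁: if the point (μ̄, p̄) = (1/t)·(μ₀, p₀) + (1 − 1/t)·(μ₁, p₁) satisfies μ̄ ≥ 1 − ε and p̄ ≤ 3/4 + ε, then t ≥ κ/ε. -/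
/-- The rate-power curve for Case 1 (channel states 1 and 2 with probabilities 3/4, 1/4). -/
noncomputable def h1 (μ : ℝ) : ℝ := if μ ≤ 1 / 2 then μ / 2 else μ - 1 / 4

/-- The one-slot performance region `R₁`. -/
def R1 : Set (ℝ × ℝ) :=
  {q | 0 ≤ q.1 ∧ q.1 ≤ 5 / 4 ∧ h1 q.1 ≤ q.2 ∧ q.2 ≤ 1}

/-- The slot-0 performance points `S₁` when the transmit probability in channel state 2
is at most 1/2. -/
def S1 : Set (ℝ × ℝ) :=
  {q | ∃ θ1 ∈ Set.Icc (0 : ℝ) 1, ∃ θ2 ∈ Set.Icc (0 : ℝ) (1 / 2),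
    q = (θ2 / 2 + 3 * θ1 / 4, θ2 / 4 + 3 * θ1 / 4)}

theorem sub_quarter_le_h1 (μ : ℝ) : μ - 1 / 4 ≤ h1 μ := by
  unfold h1
  split_ifs <;> linarith

theorem sub_le_of_mem_R1 {μ p : ℝ} (h : (μ, p) ∈ R1) : μ - p ≤ 1 / 4 := by
  obtain ⟨-, -, h, -⟩ := h
  have := sub_quarter_le_h1 μ
  dsimp only at h
  linarith

theorem sub_le_of_mem_S1 {μ p : ℝ} (h : (μ, p) ∈ S1) : μ - p ≤ 1 / 8 := by
  obtain ⟨θ1, -, θ2, ⟨-, hθ2⟩, h⟩ := h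
  obtain ⟨rfl, rfl⟩ := Prod.mk.inj h
  linarith

/-- There is a constant `κ > 0` such that for every `0 < ε < 1/64`, every
integer `t ≥ 1`, every `(μ₀,p₀) ∈ S₁` and `(μ₁,p₁) ∈ R₁`: if
`(μ̄,p̄) = (1/t)(μ₀,p₀) + (1 − 1/t)(μ₁,p₁)` satisfies `μ̄ ≥ 1 − ε` and `p̄ ≤ 3/4 + ε`,
then `t ≥ κ/ε`. -/
theorem stmt16 :
    ∃ κ : ℝ, 0 < κ ∧
      ∀ ε : ℝ, 0 < ε → ε < 1 / 64 →
        ∀ t : ℕ, 1 ≤ t →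
          ∀ μ0 p0 μ1 p1 : ℝ, (μ0, p0) ∈ S1 → (μ1, p1) ∈ R1 →
            1 - ε ≤ (1 / (t : ℝ)) * μ0 + (1 - 1 / (t : ℝ)) * μ1 →
            (1 / (t : ℝ)) * p0 + (1 - 1 / (t : ℝ)) * p1 ≤ 3 / 4 + ε →
            κ / ε ≤ (t : ℝ) := by
  refine ⟨1 / 16, by norm_num, fun ε hε _ t ht μ0 p0 μ1 p1 h0 h1 hμ hp => ?_⟩
  have ht' : (1 : ℝ) ≤ t := by exact_mod_cast ht
  have hs0 : 0 ≤ 1 / (t : ℝ) := by positivity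
  have hs1 : 0 ≤ 1 - 1 / (t : ℝ) := sub_nonneg.2 ((div_le_one (by linarith)).2 ht')
  have e0 := mul_le_mul_of_nonneg_left (sub_le_of_mem_S1 h0) hs0
  have e1 := mul_le_mul_of_nonneg_left (sub_le_of_mem_R1 h1) hs1
  have key : 1 / (t : ℝ) ≤ 16 * ε := by linarith
  rw [div_le_iff₀ (by linarith)] at key
  rw [div_le_iff₀ hε]
  linarith
end

section
/- There exists a constant κ > 0 such that the following holds. For every ε with 0 < ε < 1/64, every integer t ≥ 1, every (μ₀, p₀) ∈ S₂, and every (μ₁, p₁) ∈ R₂: if the point (μ̄, p̄) = (1/t)·(μ₀, p₀) + (1 − 1/t)·(μ₁, p₁) satisfies μ̄ ≥ 1 − ε and p̄ ≤ 1/3 + ε, then t ≥ κ/ε. -/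
/-- The rate-power curve for Case 2 (channel states 2 and 3, each with probability 1/2). -/
noncomputable def h2 (μ : ℝ) : ℝ :=
  if μ ≤ 3 / 2 then μ / 3 else 1 / 2 + (μ - 3 / 2) / 2

/-- The one-slot performance region `R₂`. -/
def R2 : Set (ℝ × ℝ) :=
  {q | 0 ≤ q.1 ∧ q.1 ≤ 5 / 2 ∧ h2 q.1 ≤ q.2 ∧ q.2 ≤ 1}

/-- The slot-0 performance points `S₂` when the transmit probability in channel state 2
is at least 1/2. -/
def S2 : Set (ℝ × ℝ) :=
  {q | ∃ θ3 ∈ Set.Icc (0 : ℝ) 1, ∃ θ2 ∈ Set.Icc (1 / 2 : ℝ) 1,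
    q = (θ2 + 3 * θ3 / 2, θ2 / 2 + θ3 / 2)}

/-- Every point of `R₂` lies on or above the line `p = μ / 3`. -/
theorem div_three_le_of_mem_R2 {μ p : ℝ} (h : (μ, p) ∈ R2) : μ / 3 ≤ p := by
  obtain ⟨-, -, h, -⟩ := h
  refine le_trans ?_ h
  simp only [h2]
  split_ifs <;> linarith

/-- Every point of `S₂` lies at least `1 / 12` above the line `p = μ / 3`. -/
theorem div_three_add_le_of_mem_S2 {μ p : ℝ} (h : (μ, p) ∈ S2) : μ / 3 + 1 / 12 ≤ p := by
  obtain ⟨θ3, -, θ2, ⟨h, -⟩, hq⟩ := h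
  obtain ⟨rfl, rfl⟩ := Prod.mk.inj hq
  linarith

/-- There is a constant `κ > 0` such that for every `0 < ε < 1/64`, every
integer `t ≥ 1`, every `(μ₀,p₀) ∈ S₂` and `(μ₁,p₁) ∈ R₂`: if
`(μ̄,p̄) = (1/t)(μ₀,p₀) + (1 − 1/t)(μ₁,p₁)` satisfies `μ̄ ≥ 1 − ε` and `p̄ ≤ 1/3 + ε`,
then `t ≥ κ/ε`. -/
theorem stmt17 :
    ∃ κ : ℝ, 0 < κ ∧
      ∀ ε : ℝ, 0 < ε → ε < 1 / 64 →
        ∀ t : ℕ, 1 ≤ t →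
          ∀ μ0 p0 μ1 p1 : ℝ, (μ0, p0) ∈ S2 → (μ1, p1) ∈ R2 →
            1 - ε ≤ (1 / (t : ℝ)) * μ0 + (1 - 1 / (t : ℝ)) * μ1 →
            (1 / (t : ℝ)) * p0 + (1 - 1 / (t : ℝ)) * p1 ≤ 1 / 3 + ε →
            κ / ε ≤ (t : ℝ) := by
  refine ⟨1 / 16, by norm_num, ?_⟩
  intro ε hε _ t ht μ0 p0 μ1 p1 hS hR hμ hp
  have ht1 : (1 : ℝ) ≤ t := by exact_mod_cast ht
  have ht0 : (0 : ℝ) < t := by linarith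
  have hinv : 1 / (t : ℝ) ≤ 1 := (div_le_one ht0).mpr ht1
  have hS' := mul_le_mul_of_nonneg_left (div_three_add_le_of_mem_S2 hS)
    (one_div_pos.mpr ht0).le
  have hR' := mul_le_mul_of_nonneg_left (div_three_le_of_mem_R2 hR) (sub_nonneg.mpr hinv)
  have key : 1 / (t : ℝ) ≤ 16 * ε := by linarith
  rw [div_le_iff₀ ht0] at key
  rw [div_le_iff₀ hε]
  linarith
end
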